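/- Suppose the collection 𝒫_A^⊆ of potential-outcome distributions obeys distributional consistency. Let B and C be disjoint subsets of A (C possibly empty) and let W satisfy B ⊆ W ⊆ V. If the marginal distribution p(X_W(b,c)) does not depend on b (i.e., p(X_W(b,c) = w) = p(X_W(b′,c) = w) for all b, b′ ∈ 𝔛_B, c ∈ 𝔛_C, w ∈ 𝔛_W), then p(X_W(b,c) = w) = p(X_W(c) = w) for all b, c, w. -/

import Mathlib

open Finset

namespace CausalPaper

variable {V : Type*} [Fintype V] [DecidableEq V]
variable {𝔛 : V → Type*} [∀ i, Fintype (𝔛 i)]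

/-- Probability of the event `E` under the distribution `q` on joint assignments. -/
noncomputable def pr (q : (∀ i, 𝔛 i) → ℝ) (E : (∀ i, 𝔛 i) → Prop) : ℝ :=
  ∑ v : (∀ i, 𝔛 i), Set.indicator (setOf E) q v

/-- Conditional probability of `E` given `F` under `q`. -/
noncomputable def cpr (q : (∀ i, 𝔛 i) → ℝ) (E F : (∀ i, 𝔛 i) → Prop) : ℝ :=
  pr q (fun v => E v ∧ F v) / pr q F

/-- `q` is a probability distribution on joint assignments. -/
def IsProb (q : (∀ i, 𝔛 i) → ℝ) : Prop :=
  (∀ v, 0 ≤ q v) ∧ (∑ v : (∀ i, 𝔛 i), q v) = 1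

/-- `v` agrees with `s` on the coordinates in `S`. -/
def agree (S : Finset V) (s v : ∀ i, 𝔛 i) : Prop :=
  ∀ i ∈ S, v i = s i

/-- The intervention/regime that sets the variables in `B` according to `b`
(and is idle elsewhere). -/
def setOn (B : Finset V) (b : ∀ i, 𝔛 i) : ∀ i, Option (𝔛 i) :=
  fun i => if i ∈ B then some (b i) else none

/-- The intervention/regime that sets `B` according to `b` and `C` according to `c`. -/
def setOn₂ (B : Finset V) (b : ∀ i, 𝔛 i) (C : Finset V) (c : ∀ i, 𝔛 i) :
    ∀ i, Option (𝔛 i) :=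
  fun i => if i ∈ B then some (b i) else if i ∈ C then some (c i) else none

/-- The support of the partial intervention/regime `f` is contained in `A`. -/
def suppIn (f : ∀ i, Option (𝔛 i)) (A : Finset V) : Prop :=
  ∀ i, f i ≠ none → i ∈ A

/-- Distributional consistency: for `i ∈ A`, `C ⊆ A \ {i}`, the probability of the
event `{X_{V∖{i}} = y, X_i = b}` is the same whether or not `i` is additionally
intervened on and set to `b`. -/
def DistConsistent (A : Finset V) (P : (∀ i, Option (𝔛 i)) → (∀ i, 𝔛 i) → ℝ) : Prop :=
  ∀ i ∈ A, ∀ C : Finset V, C ⊆ A \ {i} →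
    ∀ (y : ∀ j, 𝔛 j) (b : 𝔛 i) (c : ∀ j, 𝔛 j),
      pr (P (Function.update (setOn C c) i (some b)))
          (fun v => agree (univ \ {i}) y v ∧ v i = b)
        = pr (P (setOn C c)) (fun v => agree (univ \ {i}) y v ∧ v i = b)

theorem pr_congr {q q' : (∀ i, 𝔛 i) → ℝ} {E : (∀ i, 𝔛 i) → Prop}
    (h : ∀ v, E v → q v = q' v) : pr q E = pr q' E := by
  exact sum_congr rfl fun v _ => congrFun (Set.indicator_congr h) v

theorem pr_eq_apply (q : (∀ i, 𝔛 i) → ℝ) (E : (∀ i, 𝔛 i) → Prop) (v : ∀ i, 𝔛 i)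
    (hE : ∀ u, E u ↔ u = v) : pr q E = q v := by
  rw [pr, sum_eq_single v]
  · exact Set.indicator_of_mem ((hE v).2 rfl) q
  · exact fun u _ hu => Set.indicator_of_notMem (fun h => hu ((hE u).1 h)) q
  · exact fun h => (h (mem_univ v)).elim

theorem DistConsistent.apply_update {A : Finset V}
    {P : (∀ i, Option (𝔛 i)) → (∀ i, 𝔛 i) → ℝ} (hDC : DistConsistent A P)
    {i : V} (hi : i ∈ A) {D : Finset V} (hD : D ⊆ A) (hiD : i ∉ D) (e v : ∀ j, 𝔛 j) :
    P (Function.update (setOn D e) i (some (v i))) v = P (setOn D e) v := by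
  have hE : ∀ u : ∀ j, 𝔛 j, (agree (univ \ {i}) v u ∧ u i = v i) ↔ u = v := by
    refine fun u => ⟨fun ⟨h, hui⟩ => funext fun j => ?_, fun h => by simp [h, agree]⟩
    by_cases hj : j = i
    · subst hj
      exact hui
    · exact h j (by simp [hj])
  have hDi : D ⊆ A \ {i} := fun j hj => by
    simp only [mem_sdiff, mem_singleton]
    exact ⟨hD hj, fun h => hiD (h ▸ hj)⟩
  have h := hDC i hi D hDi v (v i) e
  rwa [pr_eq_apply _ _ v hE, pr_eq_apply _ _ v hE] at h

omit [Fintype V] [∀ i, Fintype (𝔛 i)] in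
theorem setOn₂_eq_setOn_union (B C : Finset V) (b c : ∀ i, 𝔛 i) :
    setOn₂ B b C c = setOn (B ∪ C) (fun j => if j ∈ B then b j else c j) := by
  funext j
  by_cases hB : j ∈ B <;> by_cases hC : j ∈ C <;> simp [setOn₂, setOn, hB, hC]

omit [Fintype V] [∀ i, Fintype (𝔛 i)] in
theorem setOn₂_insert (B C : Finset V) (i : V) (b c : ∀ i, 𝔛 i) :
    setOn₂ (insert i B) b C c = Function.update (setOn₂ B b C c) i (some (b i)) := by
  funext j
  by_cases hj : j = i
  · subst hj
    simp [setOn₂]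
  · simp [setOn₂, hj]

theorem DistConsistent.apply_setOn₂_self {A : Finset V}
    {P : (∀ i, Option (𝔛 i)) → (∀ i, 𝔛 i) → ℝ} (hDC : DistConsistent A P)
    {C : Finset V} (hCA : C ⊆ A) (c v : ∀ j, 𝔛 j) (B : Finset V) (hBA : B ⊆ A)
    (hBC : Disjoint B C) : P (setOn₂ B v C c) v = P (setOn C c) v := by
  induction B using Finset.induction_on with
  | empty => simp [setOn₂_eq_setOn_union]
  | insert i B hiB ih =>
    rw [insert_subset_iff] at hBA
    rw [disjoint_insert_left] at hBC
    rw [← ih hBA.2 hBC.2, setOn₂_insert, setOn₂_eq_setOn_union]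
    exact hDC.apply_update hBA.1 (union_subset hBA.2 hCA) (by simp [hiB, hBC.1]) _ v

/-- Lemma 3: if the marginal distribution of `X_W` under intervention on `B ∪ C`
does not depend on the value `b`, then it equals the marginal under intervening
on `C` alone (for `B ⊆ W`). -/
theorem stmt2_remove_b_from_joint
    (A B C : Finset V) (hBA : B ⊆ A) (hCA : C ⊆ A) (hBC : Disjoint B C)
    (W : Finset V) (hBW : B ⊆ W)
    (P : (∀ i, Option (𝔛 i)) → (∀ i, 𝔛 i) → ℝ)
    (hP : ∀ f, suppIn f A → IsProb (P f))
    (hDC : DistConsistent A P)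
    (hIndep : ∀ (b b' c w : ∀ j, 𝔛 j),
      pr (P (setOn₂ B b C c)) (agree W w) = pr (P (setOn₂ B b' C c)) (agree W w)) :
    ∀ (b c w : ∀ j, 𝔛 j),
      pr (P (setOn₂ B b C c)) (agree W w) = pr (P (setOn C c)) (agree W w) := by
  intro b c w
  rw [hIndep b w c w]
  refine pr_congr fun v hv => ?_
  have hset : setOn₂ B w C c = setOn₂ B v C c := by
    funext j
    by_cases hj : j ∈ B
    · simp [setOn₂, hj, hv j (hBW hj)]
    · simp [setOn₂, hj]
  rw [hset]
  exact hDC.apply_setOn₂_self hCA c v B hBA hBC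

end CausalPaper
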